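/- arXiv:2603.21424 — 5 statements merged into one kernel-verified Lean document; each statement's English description precedes it below -/
import Mathlib

section
/- Let P_1,…,P_K be p-values such that P_k is superuniform for every k ∈ 𝒩, let E_1,…,E_K be compound e-values, and assume that for each k ∈ 𝒩 the random variables P_k and E_k are independent. Then the quantities Q_k = P_k/E_k (with conventions 0/0 = 0 and x/0 = ∞ for x > 0) are compound p-values, i.e., ∑_{k∈𝒩} ℙ(Q_k ≤ t) ≤ K·t for every t ∈ (0,1). -/
open MeasureTheory ProbabilityTheory ENNReal
open scoped ENNReal Classical

/-- A superuniform random variable `P` satisfies `μ {P ≤ s} ≤ s` for every threshold `s : ℝ≥0∞`. -/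
theorem measure_ofReal_le_of_superuniform {Ω : Type*} [MeasurableSpace Ω] {μ : Measure Ω}
    [IsProbabilityMeasure μ] {P : Ω → ℝ}
    (hP : ∀ t ∈ Set.Icc (0:ℝ) 1, μ {ω | P ω ≤ t} ≤ ENNReal.ofReal t) (s : ℝ≥0∞) :
    μ {ω | ENNReal.ofReal (P ω) ≤ s} ≤ s := by
  rcases le_total 1 s with h | h
  · exact prob_le_one.trans h
  · have hs : s ≠ ∞ := ne_top_of_le_ne_top one_ne_top h
    have hs1 : s.toReal ≤ 1 := toReal_le_of_le_ofReal zero_le_one (by simpa using h)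
    simpa only [ofReal_le_iff_le_toReal hs, ofReal_toReal hs]
      using hP s.toReal ⟨toReal_nonneg, hs1⟩

/-- Randomised thresholds: if `P` is superuniform and independent of `E`, then
`μ {P ≤ c * E} ≤ c * 𝔼[E]`. -/
theorem measure_ofReal_le_mul_le_of_indepFun {Ω : Type*} [MeasurableSpace Ω] {μ : Measure Ω}
    [IsProbabilityMeasure μ] {P : Ω → ℝ} {E : Ω → ℝ≥0∞} (hPm : Measurable P) (hEm : Measurable E)
    (hP : ∀ t ∈ Set.Icc (0:ℝ) 1, μ {ω | P ω ≤ t} ≤ ENNReal.ofReal t)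
    (hPE : IndepFun P E μ) (c : ℝ≥0∞) :
    μ {ω | ENNReal.ofReal (P ω) ≤ c * E ω} ≤ c * ∫⁻ ω, E ω ∂μ := by
  have hS : MeasurableSet {x : ℝ≥0∞ × ℝ | ENNReal.ofReal x.2 ≤ c * x.1} :=
    measurableSet_le (by fun_prop) (by fun_prop)
  have hjoint := (indepFun_iff_map_prod_eq_prod_map_map hEm.aemeasurable hPm.aemeasurable).1 hPE.symm
  have : IsProbabilityMeasure (μ.map P) := Measure.isProbabilityMeasure_map hPm.aemeasurable
  calc μ {ω | ENNReal.ofReal (P ω) ≤ c * E ω}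
      = μ.map (fun ω => (E ω, P ω)) {x | ENNReal.ofReal x.2 ≤ c * x.1} :=
        (Measure.map_apply (hEm.prodMk hPm) hS).symm
    _ = ∫⁻ e, μ.map P {p | ENNReal.ofReal p ≤ c * e} ∂(μ.map E) := by
        rw [hjoint, Measure.prod_apply hS]; rfl
    _ ≤ ∫⁻ e, c * e ∂(μ.map E) := by
        refine lintegral_mono fun e => ?_
        rw [Measure.map_apply hPm (measurableSet_le (by fun_prop) (by fun_prop))]
        exact measure_ofReal_le_of_superuniform hP (c * e)
    _ = c * ∫⁻ ω, E ω ∂μ := by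
        rw [lintegral_map (by fun_prop) hEm, lintegral_const_mul c hEm]

/-- If `P_k` is superuniform for every null `k`, the `E_k` are compound
e-values, and `P_k` is independent of `E_k` for every null `k`, then the quantities
`Q_k = P_k / E_k` (with conventions `0/0 = 0`, `x/0 = ∞` for `x > 0`, as given by
`ℝ≥0∞` division) are compound p-values: `∑_{k∈𝒩} ℙ(Q_k ≤ t) ≤ K·t` for all `t ∈ (0,1)`. -/
theorem compound_p_from_ep
    {Ω : Type*} [MeasurableSpace Ω] (μ : Measure Ω) [IsProbabilityMeasure μ]
    (K : ℕ) (hK : 1 ≤ K) (N : Finset (Fin K))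
    (P : Fin K → Ω → ℝ) (E : Fin K → Ω → ℝ≥0∞)
    (hPmeas : ∀ k, Measurable (P k))
    (hPrange : ∀ k ω, P k ω ∈ Set.Icc (0:ℝ) 1)
    (hEmeas : ∀ k, Measurable (E k))
    (hsup : ∀ k ∈ N, ∀ t ∈ Set.Icc (0:ℝ) 1, μ {ω | P k ω ≤ t} ≤ ENNReal.ofReal t)
    (hcompound : ∑ k ∈ N, ∫⁻ ω, E k ω ∂μ ≤ (K : ℝ≥0∞))
    (hindep : ∀ k ∈ N, IndepFun (P k) (E k) μ) :
    ∀ t ∈ Set.Ioo (0:ℝ) 1,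
      ∑ k ∈ N, μ {ω | ENNReal.ofReal (P k ω) / E k ω ≤ ENNReal.ofReal t}
        ≤ (K : ℝ≥0∞) * ENNReal.ofReal t := by
  intro t ht
  have ht0 : ENNReal.ofReal t ≠ 0 := (ofReal_pos.2 ht.1).ne'
  calc ∑ k ∈ N, μ {ω | ENNReal.ofReal (P k ω) / E k ω ≤ ENNReal.ofReal t}
      = ∑ k ∈ N, μ {ω | ENNReal.ofReal (P k ω) ≤ ENNReal.ofReal t * E k ω} := by
        simp only [ENNReal.div_le_iff_le_mul (Or.inr ofReal_ne_top) (Or.inr ht0)]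
    _ ≤ ∑ k ∈ N, ENNReal.ofReal t * ∫⁻ ω, E k ω ∂μ :=
        Finset.sum_le_sum fun k hk => measure_ofReal_le_mul_le_of_indepFun (hPmeas k) (hEmeas k)
          (hsup k hk) (hindep k hk) _
    _ = ENNReal.ofReal t * ∑ k ∈ N, ∫⁻ ω, E k ω ∂μ := Finset.mul_sum _ _ _ |>.symm
    _ ≤ K * ENNReal.ofReal t := by
        rw [mul_comm]
        gcongr
end

section
/- Let P_1,…,P_K be PRDS p-values and let E_1,…,E_K be compound e-values such that the random vector (E_1,…,E_K) is independent of the random vector (P_1,…,P_K). Then the ep-BH procedure at level α ∈ (0,1) applied to (P_1,…,P_K) and (E_1,…,E_K) satisfies FDR ≤ α. -/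
open MeasureTheory ProbabilityTheory ENNReal
open scoped ENNReal Classical

/-- The `i`-th smallest value (0-indexed) of the vector `q`, i.e. the order statistic
`q_(i+1)`. -/
noncomputable def sortedVal {K : ℕ} (q : Fin K → ℝ≥0∞) (i : Fin K) : ℝ≥0∞ :=
  q (Tuple.sort q i)

/-- `kStar q t = max {k ∈ {1,…,K} : K·q_(k) ≤ t·k}` with `max ∅ = 0`. -/
noncomputable def kStar {K : ℕ} (q : Fin K → ℝ≥0∞) (t : ℝ≥0∞) : ℕ :=
  (Finset.univ.filter (fun i : Fin K =>
      (K : ℝ≥0∞) * sortedVal q i ≤ t * ((i : ℕ) + 1))).sup (fun i => (i : ℕ) + 1)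

/-- The ep-BH rejection set at level `t` applied to `q_k = P_k/E_k`:
reject `H_k` iff `K·q_k ≤ t·kStar`. -/
noncomputable def rejectSet {K : ℕ} (q : Fin K → ℝ≥0∞) (t : ℝ≥0∞) : Finset (Fin K) :=
  Finset.univ.filter (fun k => (K : ℝ≥0∞) * q k ≤ t * (kStar q t : ℕ))

/-- The false discovery rate `𝔼[V/R]` (with `0/0 = 0`) of a random rejection set,
where `V` counts rejections with index in the null set `N` and `R` all rejections. -/
noncomputable def FDR {Ω : Type*} [MeasurableSpace Ω] (μ : Measure Ω) {K : ℕ}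
    (N : Finset (Fin K)) (reject : Ω → Finset (Fin K)) : ℝ≥0∞ :=
  ∫⁻ ω, ((reject ω ∩ N).card : ℝ≥0∞) / ((reject ω).card : ℝ≥0∞) ∂μ

theorem le_mul_sortedVal_iff {K : ℕ} (q : Fin K → ℝ≥0∞) (t : ℝ≥0∞) (i : Fin K) :
    (K : ℝ≥0∞) * sortedVal q i ≤ t * ((i : ℕ) + 1) ↔
      (i : ℕ) + 1 ≤ (Finset.univ.filter
        (fun j : Fin K => (K : ℝ≥0∞) * q j ≤ t * ((i : ℕ) + 1 : ℕ))).card := by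
  have hmono : Monotone (sortedVal q) := Tuple.monotone_sort q
  constructor
  · intro h
    have hcard : ((Finset.Iic i).map (Tuple.sort q).toEmbedding).card = (i : ℕ) + 1 := by
      rw [Finset.card_map, Fin.card_Iic]
    refine hcard.ge.trans (Finset.card_le_card fun j hj => ?_)
    obtain ⟨a, ha, rfl⟩ := Finset.mem_map.1 hj
    simp only [Finset.mem_filter, Finset.mem_univ, true_and, Nat.cast_add, Nat.cast_one]
    exact (mul_le_mul_right (hmono (Finset.mem_Iic.1 ha)) _).trans h
  · intro h
    by_contra hlt
    have hsub : (Finset.univ.filter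
        (fun j : Fin K => (K : ℝ≥0∞) * q j ≤ t * ((i : ℕ) + 1 : ℕ))) ⊆
        (Finset.Iio i).map (Tuple.sort q).toEmbedding := by
      intro j hj
      simp only [Finset.mem_filter, Finset.mem_univ, true_and, Nat.cast_add, Nat.cast_one] at hj
      refine Finset.mem_map.2 ⟨(Tuple.sort q).symm j, ?_, by simp⟩
      rw [Finset.mem_Iio]
      by_contra hle
      have hle := hmono (not_lt.1 hle)
      have heq : sortedVal q ((Tuple.sort q).symm j) = q j := by simp [sortedVal]
      rw [heq] at hle
      exact hlt ((mul_le_mul_right hle _).trans hj)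
    have := Finset.card_le_card hsub
    rw [Finset.card_map, Fin.card_Iio] at this
    omega

theorem le_kStar {K : ℕ} {q : Fin K → ℝ≥0∞} {t : ℝ≥0∞} {m : ℕ}
    (hm : m ≤ (Finset.univ.filter (fun j : Fin K => (K : ℝ≥0∞) * q j ≤ t * (m : ℕ))).card) :
    m ≤ kStar q t := by
  rcases m with _ | m
  · exact Nat.zero_le _
  have hmK : m < K := by
    have := hm.trans (Finset.card_le_univ _)
    rw [Fintype.card_fin] at this
    omega
  exact Finset.le_sup (f := fun i : Fin K => (i : ℕ) + 1) (b := ⟨m, hmK⟩)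
    (Finset.mem_filter.2 ⟨Finset.mem_univ _, (le_mul_sortedVal_iff q t ⟨m, hmK⟩).2 hm⟩)

theorem kStar_le_card_rejectSet {K : ℕ} (q : Fin K → ℝ≥0∞) (t : ℝ≥0∞) :
    kStar q t ≤ (rejectSet q t).card := by
  rcases Finset.eq_empty_or_nonempty (Finset.univ.filter (fun i : Fin K =>
      (K : ℝ≥0∞) * sortedVal q i ≤ t * ((i : ℕ) + 1))) with h | h
  · simp [kStar, h]
  · obtain ⟨i, hi, heq⟩ := Finset.exists_mem_eq_sup _ h (fun i : Fin K => (i : ℕ) + 1)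
    have hk : kStar q t = (i : ℕ) + 1 := heq
    rw [rejectSet, hk]
    exact (le_mul_sortedVal_iff q t i).1 (Finset.mem_filter.1 hi).2

theorem card_rejectSet {K : ℕ} (q : Fin K → ℝ≥0∞) (t : ℝ≥0∞) :
    (rejectSet q t).card = kStar q t := by
  refine le_antisymm (le_kStar (Finset.card_le_card fun j hj => ?_)) (kStar_le_card_rejectSet q t)
  refine Finset.mem_filter.2 ⟨Finset.mem_univ _, (Finset.mem_filter.1 hj).2.trans ?_⟩
  gcongr
  exact kStar_le_card_rejectSet q t

theorem kStar_le {K : ℕ} (q : Fin K → ℝ≥0∞) (t : ℝ≥0∞) : kStar q t ≤ K := by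
  simpa using (kStar_le_card_rejectSet q t).trans (Finset.card_le_univ _)

theorem kStar_antitone {K : ℕ} (t : ℝ≥0∞) :
    Antitone (fun q : Fin K → ℝ≥0∞ => kStar q t) := by
  intro q q' h
  refine le_kStar ((kStar_le_card_rejectSet q' t).trans (Finset.card_le_card fun j hj => ?_))
  exact Finset.mem_filter.2 ⟨Finset.mem_univ _,
    (mul_le_mul_right (h j) _).trans (Finset.mem_filter.1 hj).2⟩

theorem measurable_kStar {K : ℕ} (t : ℝ≥0∞) :
    Measurable (fun q : Fin K → ℝ≥0∞ => kStar q t) := by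
  refine measurable_of_Ici fun r => ?_
  have heq : (fun q : Fin K → ℝ≥0∞ => kStar q t) ⁻¹' Set.Ici r = ⋃ m ∈ Set.Ici r,
      {q | m ≤ (Finset.univ.filter
        (fun j : Fin K => (K : ℝ≥0∞) * q j ≤ t * (m : ℕ))).card} := by
    ext q
    simp only [Set.mem_preimage, Set.mem_Ici, Set.mem_iUnion, Set.mem_ofPred_eq, exists_prop]
    exact ⟨fun h => ⟨kStar q t, h, kStar_le_card_rejectSet q t⟩,
      fun ⟨m, hrm, hm⟩ => hrm.trans (le_kStar hm)⟩
  rw [heq]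
  refine MeasurableSet.biUnion (Set.to_countable _) fun m _ => ?_
  simp only [Finset.card_filter]
  refine measurableSet_le measurable_const (Finset.measurable_sum _ fun j _ => ?_)
  exact Measurable.ite (measurableSet_le ((measurable_pi_apply j).const_mul _) measurable_const)
    measurable_const measurable_const

/-- If the integer-valued variable `R` is stochastically non-increasing in the superuniform
variable `X` in the PRDS sense, then `𝔼[1{X ≤ c R} / R] ≤ c`. -/
theorem lintegral_inv_of_le_mul_le {Ω : Type*} [MeasurableSpace Ω] (μ : Measure Ω)
    [IsProbabilityMeasure μ] {K : ℕ} {X : Ω → ℝ} {R : Ω → ℕ} {c : ℝ} (hc : 0 ≤ c)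
    (hX : Measurable X) (hX1 : ∀ ω, X ω ≤ 1) (hR : Measurable R) (hRK : ∀ ω, R ω ≤ K)
    (hsup : ∀ t ∈ Set.Icc (0 : ℝ) 1, μ {ω | X ω ≤ t} ≤ ENNReal.ofReal t)
    (hdep : ∀ r : ℕ, ∀ x ∈ Set.Icc (0 : ℝ) 1, ∀ y ∈ Set.Icc (0 : ℝ) 1, x ≤ y →
      0 < μ {ω | X ω ≤ x} → 0 < μ {ω | X ω ≤ y} →
      μ ({ω | R ω ≤ r} ∩ {ω | X ω ≤ x}) / μ {ω | X ω ≤ x}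
        ≤ μ ({ω | R ω ≤ r} ∩ {ω | X ω ≤ y}) / μ {ω | X ω ≤ y}) :
    ∫⁻ ω, (if 1 ≤ R ω ∧ X ω ≤ c * R ω then (R ω : ℝ≥0∞)⁻¹ else 0) ∂μ ≤ ENNReal.ofReal c := by
  set x : ℕ → ℝ := fun r => min (c * r) 1 with hx
  have hx01 (r : ℕ) : x r ∈ Set.Icc (0 : ℝ) 1 :=
    ⟨le_min (by positivity) zero_le_one, min_le_right _ _⟩
  have hxmono : Monotone x := fun a b hab => by
    simp only [hx]
    gcongr
  have hmX (r : ℕ) : MeasurableSet {ω | X ω ≤ x r} := measurableSet_le hX measurable_const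
  have hmR (r : ℕ) : MeasurableSet {ω | R ω = r} := hR (measurableSet_singleton r)
  have hpt (ω : Ω) : (if 1 ≤ R ω ∧ X ω ≤ c * R ω then (R ω : ℝ≥0∞)⁻¹ else 0) =
      ∑ m ∈ Finset.range K, ({ω | R ω = m + 1} ∩ {ω | X ω ≤ x (m + 1)}).indicator
        (fun _ => ((m + 1 : ℕ) : ℝ≥0∞)⁻¹) ω := by
    have hXx (r : ℕ) : X ω ≤ x r ↔ X ω ≤ c * r := by simp [hx, hX1 ω]
    simp only [Set.indicator_apply, Set.mem_inter_iff, Set.mem_ofPred_eq, hXx]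
    rcases hr : R ω with _ | r
    · simp
    · have hrK : r < K := by
        have := hRK ω
        omega
      rw [Finset.sum_eq_single r]
      · simp
      · intro b _ hb
        rw [if_neg]
        omega
      · intro h
        simp [hrK] at h
  have hsum (n : ℕ) : ∑ m ∈ Finset.range n, ((m + 1 : ℕ) : ℝ≥0∞)⁻¹ *
      μ ({ω | R ω = m + 1} ∩ {ω | X ω ≤ x (m + 1)}) ≤
      ENNReal.ofReal c * (μ ({ω | R ω ≤ n} ∩ {ω | X ω ≤ x n}) / μ {ω | X ω ≤ x n}) := by
    induction n with
    | zero => simp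
    | succ n ih =>
      rw [Finset.sum_range_succ]
      have hp : μ {ω | X ω ≤ x n} ≤ μ {ω | X ω ≤ x (n + 1)} :=
        measure_mono fun ω hω => le_trans hω (hxmono n.le_succ)
      rcases eq_or_ne (μ {ω | X ω ≤ x (n + 1)}) 0 with h0 | h0
      · have h0' : μ ({ω | R ω ≤ n} ∩ {ω | X ω ≤ x n}) = 0 :=
          measure_mono_null Set.inter_subset_right (le_antisymm (hp.trans h0.le) zero_le)
        rw [measure_mono_null Set.inter_subset_right h0, mul_zero, add_zero]
        rw [h0', ENNReal.zero_div, mul_zero] at ih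
        exact ih.trans zero_le
      · have hsplit : μ ({ω | R ω ≤ n + 1} ∩ {ω | X ω ≤ x (n + 1)}) =
            μ ({ω | R ω ≤ n} ∩ {ω | X ω ≤ x (n + 1)}) +
            μ ({ω | R ω = n + 1} ∩ {ω | X ω ≤ x (n + 1)}) := by
          rw [← measure_union _ ((hmR (n + 1)).inter (hmX (n + 1))), ← Set.union_inter_distrib_right]
          · congr 2
            ext ω
            simp only [Set.mem_ofPred_eq, Set.mem_union]
            omega
          · rw [Set.disjoint_left]
            rintro ω ⟨h1, -⟩ ⟨h2, -⟩
            simp only [Set.mem_ofPred_eq] at h1 h2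
            omega
        rw [hsplit, ENNReal.add_div, mul_add]
        gcongr ?_ + ?_
        · refine ih.trans ?_
          gcongr ENNReal.ofReal c * ?_
          rcases eq_or_ne (μ {ω | X ω ≤ x n}) 0 with h0' | h0'
          · rw [measure_mono_null Set.inter_subset_right h0', ENNReal.zero_div]
            exact zero_le
          · exact hdep n _ (hx01 _) _ (hx01 _) (hxmono n.le_succ) (pos_iff_ne_zero.2 h0')
              (pos_iff_ne_zero.2 h0)
        · have hle : μ {ω | X ω ≤ x (n + 1)} ≤ ENNReal.ofReal c * ((n + 1 : ℕ) : ℝ≥0∞) := by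
            refine (hsup _ (hx01 _)).trans ?_
            rw [← ENNReal.ofReal_natCast, ← ENNReal.ofReal_mul hc]
            exact ENNReal.ofReal_le_ofReal (min_le_left _ _)
          have hinv : ((n + 1 : ℕ) : ℝ≥0∞)⁻¹ ≤
              ENNReal.ofReal c * (μ {ω | X ω ≤ x (n + 1)})⁻¹ := by
            rw [← div_eq_mul_inv, ENNReal.le_div_iff_mul_le (Or.inl h0)
              (Or.inl (measure_ne_top _ _)), mul_comm, ← div_eq_mul_inv]
            exact ENNReal.div_le_of_le_mul hle
          rw [div_eq_mul_inv, mul_comm (μ ({ω | R ω = n + 1} ∩ _)), ← mul_assoc]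
          gcongr
  simp only [hpt]
  rw [lintegral_finsetSum _ fun m _ =>
    measurable_const.indicator ((hmR (m + 1)).inter (hmX (m + 1)))]
  simp only [lintegral_indicator_const ((hmR _).inter (hmX _))]
  refine (hsum K).trans (mul_le_of_le_one_right' (ENNReal.div_le_of_le_mul ?_))
  rw [one_mul]
  exact measure_mono Set.inter_subset_right

theorem ofReal_le_of_mul_div_le {K : ℕ} (hK : 1 ≤ K) {x α : ℝ} (hα : 0 ≤ α) {e : ℝ≥0∞}
    (he : e ≠ ∞) {r : ℕ}
    (h : (K : ℝ≥0∞) * (ENNReal.ofReal x / e) ≤ ENNReal.ofReal α * (r : ℕ)) :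
    x ≤ α * e.toReal / K * r := by
  have hK0 : (0 : ℝ) < K := by exact_mod_cast hK
  rcases le_or_gt x 0 with hx | hx
  · exact hx.trans (by positivity)
  have htop : ENNReal.ofReal α * (r : ℕ) ≠ ∞ := by finiteness
  rcases eq_or_ne e 0 with rfl | he0
  · rw [ENNReal.div_zero (by simpa using hx), ENNReal.mul_top (by simp; omega), top_le_iff] at h
    exact absurd h htop
  · have := ENNReal.toReal_mono htop h
    have hepos := ENNReal.toReal_pos he0 he
    simp only [ENNReal.toReal_mul, ENNReal.toReal_div, ENNReal.toReal_natCast,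
      ENNReal.toReal_ofReal hx.le, ENNReal.toReal_ofReal hα] at this
    rw [← mul_div_assoc, div_le_iff₀ hepos] at this
    rw [div_mul_eq_mul_div, le_div_iff₀ hK0]
    linarith

theorem card_inter_div_card_rejectSet {K : ℕ} (N : Finset (Fin K)) (q : Fin K → ℝ≥0∞)
    (t : ℝ≥0∞) :
    ((rejectSet q t ∩ N).card : ℝ≥0∞) / ((rejectSet q t).card : ℝ≥0∞) =
      ∑ k ∈ N, if 1 ≤ kStar q t ∧ (K : ℝ≥0∞) * q k ≤ t * (kStar q t : ℕ)
        then (kStar q t : ℝ≥0∞)⁻¹ else 0 := by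
  rw [← Finset.sum_filter, Finset.sum_const, card_rejectSet, nsmul_eq_mul, div_eq_mul_inv]
  congr 3
  ext k
  simp only [Finset.mem_inter, Finset.mem_filter]
  constructor
  · rintro ⟨hk, hN⟩
    have := Finset.card_pos.2 ⟨k, hk⟩
    rw [card_rejectSet] at this
    exact ⟨hN, this, (Finset.mem_filter.1 hk).2⟩
  · rintro ⟨hN, -, hk⟩
    exact ⟨Finset.mem_filter.2 ⟨Finset.mem_univ _, hk⟩, hN⟩

/-- For PRDS p-values `P_1,…,P_K` and compound e-values `E_1,…,E_K`
with `(E_1,…,E_K)` independent of `(P_1,…,P_K)`, the ep-BH procedure at level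
`α ∈ (0,1)` has `FDR ≤ α`. -/
theorem epBH_FDR_of_PRDS_indep
    {Ω : Type*} [MeasurableSpace Ω] (μ : Measure Ω) [IsProbabilityMeasure μ]
    (K : ℕ) (hK : 1 ≤ K) (N : Finset (Fin K))
    (P : Fin K → Ω → ℝ) (E : Fin K → Ω → ℝ≥0∞)
    (hPmeas : ∀ k, Measurable (P k))
    (hPrange : ∀ k ω, P k ω ∈ Set.Icc (0:ℝ) 1)
    (hEmeas : ∀ k, Measurable (E k))
    -- the p-values are PRDS: null p-values are superuniform …
    (hsup : ∀ k ∈ N, ∀ t ∈ Set.Icc (0:ℝ) 1, μ {ω | P k ω ≤ t} ≤ ENNReal.ofReal t)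
    -- … and for every null `k` and measurable non-decreasing set `A ⊆ ℝ^K`, the map
    -- `x ↦ ℙ(P ∈ A ∣ P_k ≤ x)` is non-decreasing over `x ∈ [0,1]` with `ℙ(P_k ≤ x) > 0`
    (hPRDS : ∀ k ∈ N, ∀ A : Set (Fin K → ℝ), MeasurableSet A →
      (∀ x ∈ A, ∀ y : Fin K → ℝ, x ≤ y → y ∈ A) →
      ∀ x ∈ Set.Icc (0:ℝ) 1, ∀ y ∈ Set.Icc (0:ℝ) 1, x ≤ y →
        0 < μ {ω | P k ω ≤ x} → 0 < μ {ω | P k ω ≤ y} →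
        μ ({ω | (fun j => P j ω) ∈ A} ∩ {ω | P k ω ≤ x}) / μ {ω | P k ω ≤ x}
          ≤ μ ({ω | (fun j => P j ω) ∈ A} ∩ {ω | P k ω ≤ y}) / μ {ω | P k ω ≤ y})
    -- the `E_k` are compound e-values
    (hcompound : ∑ k ∈ N, ∫⁻ ω, E k ω ∂μ ≤ (K : ℝ≥0∞))
    -- the vector `(E_1,…,E_K)` is independent of the vector `(P_1,…,P_K)`
    (hindep : IndepFun (fun ω (k : Fin K) => E k ω) (fun ω (k : Fin K) => P k ω) μ)
    (α : ℝ) (hα : α ∈ Set.Ioo (0:ℝ) 1) :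
    FDR μ N (fun ω =>
        rejectSet (fun k => ENNReal.ofReal (P k ω) / E k ω) (ENNReal.ofReal α))
      ≤ ENNReal.ofReal α := by
  obtain ⟨hα0, -⟩ := hα
  have hK0 : (K : ℝ≥0∞) ≠ 0 := by simp; omega
  set F : Fin K → (Fin K → ℝ≥0∞) × (Fin K → ℝ) → ℝ≥0∞ := fun k z =>
    if 1 ≤ kStar (fun j => ENNReal.ofReal (z.2 j) / z.1 j) (ENNReal.ofReal α) ∧
        (K : ℝ≥0∞) * (ENNReal.ofReal (z.2 k) / z.1 k) ≤ ENNReal.ofReal α *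
          (kStar (fun j => ENNReal.ofReal (z.2 j) / z.1 j) (ENNReal.ofReal α) : ℕ)
      then (kStar (fun j => ENNReal.ofReal (z.2 j) / z.1 j) (ENNReal.ofReal α) : ℝ≥0∞)⁻¹
      else 0 with hF
  have hq (k : Fin K) : Measurable fun z : (Fin K → ℝ≥0∞) × (Fin K → ℝ) =>
      ENNReal.ofReal (z.2 k) / z.1 k := by fun_prop
  have hS : Measurable fun z : (Fin K → ℝ≥0∞) × (Fin K → ℝ) =>
      kStar (fun j => ENNReal.ofReal (z.2 j) / z.1 j) (ENNReal.ofReal α) :=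
    (measurable_kStar _).comp (measurable_pi_iff.2 hq)
  have hScast : Measurable fun z : (Fin K → ℝ≥0∞) × (Fin K → ℝ) =>
      (kStar (fun j => ENNReal.ofReal (z.2 j) / z.1 j) (ENNReal.ofReal α) : ℝ≥0∞) :=
    measurable_from_top.comp hS
  have hFmeas (k : Fin K) : Measurable (F k) :=
    Measurable.ite ((measurableSet_le measurable_const hS).inter
      (measurableSet_le ((hq k).const_mul _) (hScast.const_mul _))) hScast.inv measurable_const
  have hEv : Measurable fun ω (k : Fin K) => E k ω := measurable_pi_iff.2 hEmeas
  have hPv : Measurable fun ω (k : Fin K) => P k ω := measurable_pi_iff.2 hPmeas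
  have hfix (k : Fin K) (hk : k ∈ N) (e : Fin K → ℝ≥0∞) :
      ∫⁻ ω, F k (e, fun j => P j ω) ∂μ ≤ ENNReal.ofReal α / K * e k := by
    rcases eq_or_ne (e k) ∞ with he | he
    · rw [he, ENNReal.mul_top]
      · exact le_top
      · simp [hα0]
    set R : (Fin K → ℝ) → ℕ := fun x =>
      kStar (fun j => ENNReal.ofReal (x j) / e j) (ENNReal.ofReal α)
    have hR : Measurable R := (measurable_kStar _).comp (measurable_pi_iff.2 fun j => by fun_prop)
    have hRanti : Antitone R := fun x y hxy =>
      kStar_antitone _ fun j => ENNReal.div_le_div_right (ENNReal.ofReal_le_ofReal (hxy j)) _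
    have hmain := lintegral_inv_of_le_mul_le μ (K := K) (X := P k)
      (R := fun ω => R fun j => P j ω) (c := α * (e k).toReal / K) (by positivity)
      (hPmeas k) (fun ω => (hPrange k ω).2) (hR.comp hPv) (fun ω => kStar_le _ _) (hsup k hk)
      (fun r => hPRDS k hk {x | R x ≤ r} (measurableSet_le hR measurable_const)
        fun x hx y hxy => (hRanti hxy).trans hx)
    refine (lintegral_mono fun ω => ?_).trans (hmain.trans_eq ?_)
    · simp only [hF]
      split_ifs with h1 h2
      · exact le_rfl
      · exact absurd ⟨h1.1, ofReal_le_of_mul_div_le hK hα0.le he h1.2⟩ h2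
      · exact zero_le
      · exact le_rfl
    · rw [ENNReal.ofReal_div_of_pos (by exact_mod_cast hK), ENNReal.ofReal_mul hα0.le,
        ENNReal.ofReal_toReal he, ENNReal.ofReal_natCast, ENNReal.mul_div_right_comm]
  have hterm (k : Fin K) (hk : k ∈ N) :
      ∫⁻ ω, F k (fun j => E j ω, fun j => P j ω) ∂μ ≤
        ENNReal.ofReal α / K * ∫⁻ ω, E k ω ∂μ := by
    have hmap := (indepFun_iff_map_prod_eq_prod_map_map hEv.aemeasurable hPv.aemeasurable).1 hindep
    rw [← lintegral_map (hFmeas k) (hEv.prodMk hPv), hmap,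
      lintegral_prod _ (hFmeas k).aemeasurable, lintegral_map (hFmeas k).lintegral_prod_right' hEv,
      ← lintegral_const_mul _ (hEmeas k)]
    refine lintegral_mono fun ω => ?_
    have hsec : Measurable fun y => F k (fun j => E j ω, y) :=
      (hFmeas k).comp measurable_prodMk_left
    rw [lintegral_map hsec hPv]
    exact hfix k hk _
  have hFEP (k : Fin K) : Measurable fun ω => F k (fun j => E j ω, fun j => P j ω) :=
    (hFmeas k).comp (hEv.prodMk hPv)
  calc _ = ∫⁻ ω, ∑ k ∈ N, F k (fun j => E j ω, fun j => P j ω) ∂μ := by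
        simp only [FDR, card_inter_div_card_rejectSet, hF]
    _ = ∑ k ∈ N, ∫⁻ ω, F k (fun j => E j ω, fun j => P j ω) ∂μ :=
        lintegral_finsetSum _ fun k _ => hFEP k
    _ ≤ ∑ k ∈ N, ENNReal.ofReal α / K * ∫⁻ ω, E k ω ∂μ := Finset.sum_le_sum hterm
    _ = ENNReal.ofReal α / K * ∑ k ∈ N, ∫⁻ ω, E k ω ∂μ := by rw [Finset.mul_sum]
    _ ≤ ENNReal.ofReal α / K * K := by gcongr
    _ = ENNReal.ofReal α := ENNReal.div_mul_cancel hK0 (ENNReal.natCast_ne_top K)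
end

section
/- Let X be a random variable with the Binomial(n,q) distribution, where n ∈ ℕ and q ∈ (0,1]. Then 𝔼[1/((X+1)(X+2))] ≤ 1/((n+1)(n+2)q²). -/
open MeasureTheory ENNReal
open scoped ENNReal

/-- The absorption identity for binomial coefficients, applied twice. -/
theorem choose_mul_one_div_add_one_mul_add_two (n k : ℕ) :
    (n.choose k : ℝ) * (1 / (((k : ℝ) + 1) * ((k : ℝ) + 2))) =
      ((n + 2).choose (k + 2) : ℝ) / (((n : ℝ) + 1) * ((n : ℝ) + 2)) := by
  have h₁ : ((n : ℝ) + 1) * n.choose k = (n + 1).choose (k + 1) * ((k : ℝ) + 1) := by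
    exact_mod_cast Nat.add_one_mul_choose_eq n k
  have h₂ : ((n : ℝ) + 2) * (n + 1).choose (k + 1) = (n + 2).choose (k + 2) * ((k : ℝ) + 2) := by
    exact_mod_cast Nat.add_one_mul_choose_eq (n + 1) (k + 1)
  field_simp
  linear_combination ((n : ℝ) + 2) * h₁ + ((k : ℝ) + 1) * h₂

/-- A tail of the binomial expansion of `(q + (1 - q)) ^ (n + 2) = 1`. -/
theorem sum_choose_add_two_mul_le_one (n : ℕ) {q : ℝ} (hq : 0 ≤ q) (hq1 : q ≤ 1) :
    ∑ k ∈ Finset.range (n + 1),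
      ((n + 2).choose (k + 2) : ℝ) * q ^ (k + 2) * (1 - q) ^ (n - k) ≤ 1 := by
  have hq' : 0 ≤ 1 - q := sub_nonneg.2 hq1
  have h := add_pow q (1 - q) (n + 2)
  rw [add_sub_cancel, one_pow, Finset.sum_range_succ', Finset.sum_range_succ'] at h
  simp only [add_assoc, one_add_one_eq_two, Nat.add_sub_add_right] at h
  refine h.symm.le.trans' <| le_add_of_le_of_nonneg (Finset.sum_le_sum fun k _ => le_of_eq (by ring)) (by positivity)

/-- The second-order inverse moment bound, for the binomial weights. -/
theorem sum_binomial_mul_one_div_le (n : ℕ) {q : ℝ} (hq : 0 < q) (hq1 : q ≤ 1) :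
    ∑ k ∈ Finset.range (n + 1), (1 / (((k : ℝ) + 1) * ((k : ℝ) + 2))) *
        ((n.choose k : ℝ) * q ^ k * (1 - q) ^ (n - k))
      ≤ 1 / (((n : ℝ) + 1) * ((n : ℝ) + 2) * q ^ 2) := by
  rw [le_div_iff₀ (by positivity)]
  refine le_of_eq_of_le ?_ (sum_choose_add_two_mul_le_one n hq.le hq1)
  rw [Finset.sum_mul]
  refine Finset.sum_congr rfl fun k _ => ?_
  have h := choose_mul_one_div_add_one_mul_add_two n k
  rw [_root_.eq_div_iff (by positivity)] at h
  linear_combination q ^ (k + 2) * (1 - q) ^ (n - k) * h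

/-- If `X ~ Binomial(n,q)` with `q ∈ (0,1]`, then
`𝔼[1/((X+1)(X+2))] ≤ 1/((n+1)(n+2)q²)`. -/
theorem binomial_second_order_bound
    {Ω : Type*} [MeasurableSpace Ω] (μ : Measure Ω) [IsProbabilityMeasure μ]
    (n : ℕ) (q : ℝ) (hq : 0 < q) (hq1 : q ≤ 1)
    (X : Ω → ℕ) (hX : Measurable X)
    (hdist : ∀ k : ℕ, μ {ω | X ω = k} =
      ENNReal.ofReal (if k ≤ n then (n.choose k : ℝ) * q ^ k * (1 - q) ^ (n - k) else 0)) :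
    ∫⁻ ω, ENNReal.ofReal (1 / (((X ω : ℝ) + 1) * ((X ω : ℝ) + 2))) ∂μ
      ≤ ENNReal.ofReal (1 / (((n : ℝ) + 1) * ((n : ℝ) + 2) * q ^ 2)) := by
  have hq' : 0 ≤ 1 - q := sub_nonneg.2 hq1
  have hmap (k : ℕ) : μ.map X {k} =
      ENNReal.ofReal (if k ≤ n then (n.choose k : ℝ) * q ^ k * (1 - q) ^ (n - k) else 0) :=
    (Measure.map_apply hX (measurableSet_singleton k)).trans (hdist k)
  rw [← lintegral_map (f := fun k : ℕ => ENNReal.ofReal (1 / (((k : ℝ) + 1) * ((k : ℝ) + 2))))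
    .of_discrete hX, lintegral_countable', tsum_eq_sum (s := Finset.range (n + 1))]
  · refine le_of_eq_of_le ?_ (ENNReal.ofReal_le_ofReal (sum_binomial_mul_one_div_le n hq hq1))
    rw [ENNReal.ofReal_sum_of_nonneg fun k _ => by positivity]
    refine Finset.sum_congr rfl fun k hk => ?_
    rw [hmap, if_pos (Finset.mem_range_succ_iff.1 hk), ← ENNReal.ofReal_mul (by positivity)]
  · intro k hk
    rw [hmap, if_neg fun h => hk (Finset.mem_range_succ_iff.2 h), ENNReal.ofReal_zero, mul_zero]
end

section
/- Fix an integer K ≥ 1, a level t ∈ (0,1), an index k ∈ 𝒦, and any p ∈ [0,1]^K. Then R_{BH,t}(p_{k→1}) ≤ ∑_{ℓ≠k} 1{p_ℓ ≤ t(K−1)/K}; equivalently, K − R_{BH,t}(p_{k→1}) ≥ 1 + ∑_{ℓ≠k} 1{p_ℓ > t(K−1)/K}. -/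
open MeasureTheory ENNReal
open scoped ENNReal Classical

/-- The number of rejections of the p-BH procedure at level `t` applied to the
p-value vector `p`. -/
noncomputable def RBH {K : ℕ} (t : ℝ) (p : Fin K → ℝ) : ℕ :=
  (rejectSet (fun k => ENNReal.ofReal (p k)) (ENNReal.ofReal t)).card

theorem le_sortedVal_last {K : ℕ} (q : Fin K → ℝ≥0∞) (j i : Fin K) (hi : (i : ℕ) + 1 = K) :
    q j ≤ sortedVal q i := by
  have h := Tuple.monotone_sort q
    (show (Tuple.sort q).symm j ≤ i from Fin.le_def.2 (by omega))
  simpa [sortedVal] using h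

/-- If some coordinate is at least `1` and `t < 1`, the largest order statistic never passes. -/
theorem kStar_lt_of_one_le {K : ℕ} (q : Fin K → ℝ≥0∞) {t : ℝ≥0∞} (ht : t < 1) (k : Fin K)
    (hk : 1 ≤ q k) : kStar q t < K := by
  rw [kStar, Finset.sup_lt_iff k.pos]
  intro i hi
  rw [Finset.mem_filter] at hi
  refine lt_of_le_of_ne i.isLt fun hiK => ?_
  have hcast : ((i : ℕ) : ℝ≥0∞) + 1 = K := by exact_mod_cast hiK
  have hK0 : (K : ℝ≥0∞) ≠ 0 := by exact_mod_cast k.pos.ne'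
  have hle : (K : ℝ≥0∞) ≤ t * K := calc
    (K : ℝ≥0∞) ≤ K * sortedVal q i :=
      le_mul_of_one_le_right' (hk.trans (le_sortedVal_last q k i hiK))
    _ ≤ t * K := hcast ▸ hi.2
  have hlt : t * K < 1 * K := ENNReal.mul_lt_mul_left hK0 (ENNReal.natCast_ne_top K) ht
  exact absurd (hle.trans_lt hlt) (by simp)

theorem mul_le_of_mem_rejectSet {K : ℕ} {t : ℝ} (ht : t ∈ Set.Ioo (0 : ℝ) 1) {p : Fin K → ℝ}
    {k l : Fin K} (hk : p k = 1)
    (hl : l ∈ rejectSet (fun i => ENNReal.ofReal (p i)) (ENNReal.ofReal t)) :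
    (K : ℝ) * p l ≤ t * ((K : ℝ) - 1) := by
  have hlt := kStar_lt_of_one_le (fun i => ENNReal.ofReal (p i))
    (t := ENNReal.ofReal t) (by simpa using ht.2) k (by simp [hk])
  rw [rejectSet, Finset.mem_filter] at hl
  have h := hl.2
  generalize kStar (fun i => ENNReal.ofReal (p i)) (ENNReal.ofReal t) = m at hlt h
  rw [← ENNReal.ofReal_natCast, ← ENNReal.ofReal_natCast,
    ← ENNReal.ofReal_mul (Nat.cast_nonneg _), ← ENNReal.ofReal_mul ht.1.le,
    ENNReal.ofReal_le_ofReal_iff (mul_nonneg ht.1.le (Nat.cast_nonneg _))] at h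
  have hm : (m : ℝ) + 1 ≤ K := by exact_mod_cast hlt
  exact h.trans (mul_le_mul_of_nonneg_left (by linarith) ht.1.le)

/-- For `t ∈ (0,1)`, `k ∈ 𝒦` and any `p ∈ [0,1]^K`,
`R_{BH,t}(p_{k→1}) ≤ ∑_{ℓ≠k} 1{p_ℓ ≤ t(K−1)/K}`; equivalently
`K − R_{BH,t}(p_{k→1}) ≥ 1 + ∑_{ℓ≠k} 1{p_ℓ > t(K−1)/K}`. -/
theorem RBH_update_one_bound (K : ℕ) (hK : 1 ≤ K)
    (t : ℝ) (ht : t ∈ Set.Ioo (0:ℝ) 1) (k : Fin K)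
    (p : Fin K → ℝ) (hp : ∀ i, p i ∈ Set.Icc (0:ℝ) 1) :
    RBH t (Function.update p k 1)
        ≤ ((Finset.univ.erase k).filter
            (fun ℓ => p ℓ ≤ t * ((K : ℝ) - 1) / K)).card
    ∧ 1 + ((Finset.univ.erase k).filter
            (fun ℓ => t * ((K : ℝ) - 1) / K < p ℓ)).card
        ≤ K - RBH t (Function.update p k 1) := by
  have hK0 : (0 : ℝ) < K := by exact_mod_cast hK
  have hle : RBH t (Function.update p k 1)
      ≤ ((Finset.univ.erase k).filter (fun ℓ => p ℓ ≤ t * ((K : ℝ) - 1) / K)).card := by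
    refine Finset.card_le_card fun l hl => ?_
    have h := mul_le_of_mem_rejectSet ht (Function.update_self k 1 p) hl
    have hlk : l ≠ k := by
      rintro rfl
      rw [Function.update_self] at h
      nlinarith [ht.1, ht.2]
    rw [Function.update_of_ne hlk] at h
    simp only [Finset.mem_filter, Finset.mem_erase, Finset.mem_univ, and_true]
    exact ⟨hlk, by rwa [le_div_iff₀' hK0]⟩
  have hcard := Finset.card_filter_add_card_filter_not (s := Finset.univ.erase k)
    (fun ℓ => p ℓ ≤ t * ((K : ℝ) - 1) / K)
  simp only [not_le, Finset.card_erase_of_mem (Finset.mem_univ k), Finset.card_univ,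
    Fintype.card_fin] at hcard
  exact ⟨hle, by omega⟩
end

section
/- Let K ≥ 2, let P_1,…,P_K be PRDS p-values, and let α ∈ (0,1) satisfy α ≤ (K−1)/K. Then the MABH quantities E_k = (K/(K−1))·1{R_{BH,α}(P) > 0}, k ∈ 𝒦, are compound e-values: ∑_{k∈𝒩} 𝔼[(K/(K−1))·1{R_{BH,α}(P) > 0}] ≤ K. -/
open MeasureTheory ENNReal
open scoped ENNReal Classical

/-- The number of coordinates `j` with `K * p j ≤ α * r`. -/
noncomputable def bhCount {K : ℕ} (α : ℝ) (r : ℕ) (p : Fin K → ℝ) : ℕ :=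
  (Finset.univ.filter (fun j => (K : ℝ) * p j ≤ α * r)).card

/-- The set of p-value vectors for which the p-BH procedure makes at most `r` rejections. -/
def bhAtMost (K : ℕ) (α : ℝ) (r : ℕ) : Set (Fin K → ℝ) :=
  {p | ∀ s : ℕ, r < s → s ≤ K → bhCount α s p < s}

theorem bhCount_antitone {K : ℕ} (α : ℝ) (r : ℕ) :
    Antitone (bhCount α r : (Fin K → ℝ) → ℕ) := by
  intro p q hpq
  refine Finset.card_le_card fun j hj => ?_
  simp only [Finset.mem_filter, Finset.mem_univ, true_and] at hj ⊢
  exact (mul_le_mul_of_nonneg_left (hpq j) (Nat.cast_nonneg K)).trans hj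

theorem measurable_bhCount {K : ℕ} (α : ℝ) (r : ℕ) :
    Measurable (bhCount α r : (Fin K → ℝ) → ℕ) := by
  have h : (bhCount α r : (Fin K → ℝ) → ℕ)
      = fun p => ∑ j, if (K : ℝ) * p j ≤ α * r then 1 else 0 := by
    funext p
    exact Finset.card_filter _ _
  rw [h]
  refine Finset.measurable_sum _ fun j _ => Measurable.ite ?_ measurable_const measurable_const
  exact measurableSet_le ((measurable_pi_apply j).const_mul _) measurable_const

theorem measurableSet_bhAtMost (K : ℕ) (α : ℝ) (r : ℕ) :
    MeasurableSet (bhAtMost K α r) := by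
  have h : bhAtMost K α r
      = ⋂ s : ℕ, ⋂ _ : r < s, ⋂ _ : s ≤ K, {p | bhCount α s p < s} := by
    ext p
    simp [bhAtMost]
  rw [h]
  exact .iInter fun s => .iInter fun _ => .iInter fun _ =>
    measurableSet_lt (measurable_bhCount α s) measurable_const

theorem bhAtMost_mono (K : ℕ) (α : ℝ) : Monotone (bhAtMost K α) :=
  fun _ _ hrs _ hp t ht htK => hp t (hrs.trans_lt ht) htK

theorem mem_bhAtMost_of_le {K : ℕ} {α : ℝ} {r : ℕ} {p q : Fin K → ℝ}
    (hp : p ∈ bhAtMost K α r) (hpq : p ≤ q) : q ∈ bhAtMost K α r :=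
  fun s hs hsK => (bhCount_antitone α s hpq).trans_lt (hp s hs hsK)

theorem bhAtMost_self (K : ℕ) (α : ℝ) : bhAtMost K α K = Set.univ :=
  Set.eq_univ_of_forall fun _ _ hs hsK => absurd hsK hs.not_ge

/-- If exactly `r + 1` hypotheses are rejected, then `r + 1` p-values lie below the
corresponding threshold. -/
theorem le_bhCount_of_mem_diff {K : ℕ} {α : ℝ} {r : ℕ} {p : Fin K → ℝ}
    (hp : p ∈ bhAtMost K α (r + 1) \ bhAtMost K α r) : r + 1 ≤ bhCount α (r + 1) p := by
  by_contra! hlt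
  refine hp.2 fun s hs hsK => ?_
  rcases (Nat.succ_le_of_lt hs).eq_or_lt with rfl | h
  · exact hlt
  · exact hp.1 s h hsK

theorem notMem_bhAtMost_zero_of_RBH_pos {K : ℕ} {α : ℝ} (hα : 0 ≤ α) {p : Fin K → ℝ}
    (h : 0 < RBH α p) : p ∉ bhAtMost K α 0 := by
  have key : ∀ (j : Fin K) (n : ℕ),
      (K : ℝ≥0∞) * ENNReal.ofReal (p j) ≤ ENNReal.ofReal α * n → (K : ℝ) * p j ≤ α * n := by
    intro j n hj
    rw [← ENNReal.ofReal_natCast, ← ENNReal.ofReal_natCast, ← ENNReal.ofReal_mul (by positivity),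
      ← ENNReal.ofReal_mul hα, ENNReal.ofReal_le_ofReal_iff (by positivity)] at hj
    exact hj
  intro hmem
  obtain ⟨k, hk⟩ := Finset.card_pos.mp h
  simp only [rejectSet, Finset.mem_filter, Finset.mem_univ, true_and] at hk
  set q : Fin K → ℝ≥0∞ := fun k => ENNReal.ofReal (p k) with hq
  have hnone : ∀ i : Fin K,
      ¬ (K : ℝ≥0∞) * sortedVal q i ≤ ENNReal.ofReal α * ((i : ℕ) + 1) := by
    intro i hi
    refine (hmem (i + 1) (Nat.succ_pos _) i.2).not_ge ?_
    have hsub : (Finset.Iic i).map (Tuple.sort q).toEmbedding ⊆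
        Finset.univ.filter (fun j => (K : ℝ) * p j ≤ α * ((i : ℕ) + 1 : ℕ)) := by
      intro j hj
      obtain ⟨l, hl, rfl⟩ := Finset.mem_map.mp hj
      refine Finset.mem_filter.mpr ⟨Finset.mem_univ _, key _ _ ?_⟩
      have hle : q (Tuple.sort q l) ≤ sortedVal q i :=
        Tuple.monotone_sort q (Finset.mem_Iic.mp hl)
      push_cast
      exact (mul_le_mul_right hle _).trans hi
    simpa [bhCount] using Finset.card_le_card hsub
  have hzero : kStar q (ENNReal.ofReal α) = 0 := by
    rw [kStar, Finset.filter_false_of_mem fun i _ => hnone i, Finset.sup_empty]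
    rfl
  rw [hzero] at hk
  have hk0 := key k 0 hk
  refine (hmem 1 one_pos k.pos).not_ge (Finset.card_pos.mpr ⟨k, ?_⟩)
  simp only [Finset.mem_filter, Finset.mem_univ, true_and]
  refine hk0.trans ?_
  simpa using hα

theorem natCast_mul_measure_le_sum_measure_inter {Ω ι : Type*} [MeasurableSpace Ω] [Fintype ι]
    (μ : Measure Ω) {D : Set Ω} (hD : MeasurableSet D) {F : ι → Set Ω}
    (hF : ∀ k, MeasurableSet (F k)) (n : ℕ)
    (h : ∀ ω ∈ D, n ≤ (Finset.univ.filter (fun k => ω ∈ F k)).card) :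
    n * μ D ≤ ∑ k, μ (D ∩ F k) := by
  calc n * μ D = ∫⁻ ω, D.indicator (fun _ => (n : ℝ≥0∞)) ω ∂μ :=
        (lintegral_indicator_const hD _).symm
    _ ≤ ∫⁻ ω, ∑ k, (D ∩ F k).indicator (fun _ => (1 : ℝ≥0∞)) ω ∂μ := by
        refine lintegral_mono fun ω => ?_
        by_cases hω : ω ∈ D
        · have := h ω hω
          simp only [Set.indicator, Set.mem_inter_iff, hω, true_and, if_true,
            Finset.sum_boole]
          exact_mod_cast this
        · simp [hω]
    _ = ∑ k, μ (D ∩ F k) := by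
        rw [lintegral_finsetSum _ fun k _ => measurable_const.indicator (hD.inter (hF k))]
        refine Finset.sum_congr rfl fun k _ => ?_
        rw [lintegral_indicator_const (hD.inter (hF k)), one_mul]

/-- A summation by parts bound: `a r` is the probability of the `r`-th conditioning event, and
`b r`, `c r` are the probabilities of its intersections with an increasing family of events. -/
theorem sum_sub_div_le_of_ratio_le {a b c : ℕ → ℝ} {β : ℝ} (hβ : 0 ≤ β)
    (hcb : ∀ r, c r ≤ b r) (hc : ∀ r, 0 ≤ c r) (hba : ∀ r, b r ≤ a r)
    (n : ℕ) (ha : ∀ r ≤ n, a r ≤ β * r) (hratio : ∀ r < n, b r / a r ≤ c (r + 1) / a (r + 1)) :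
    ∑ r ∈ Finset.range n, (b (r + 1) - c (r + 1)) / ((r : ℝ) + 1) ≤ β := by
  have ha0 : ∀ r, 0 ≤ a r := fun r => (hc r).trans ((hcb r).trans (hba r))
  have hb0 : ∀ r, 0 ≤ b r := fun r => (hc r).trans (hcb r)
  have step : ∀ m ≤ n, ∑ r ∈ Finset.range m, (b (r + 1) - c (r + 1)) / ((r : ℝ) + 1)
      ≤ β * (b m / a m) := by
    intro m
    induction m with
    | zero =>
      intro _
      simpa using mul_nonneg hβ (div_nonneg (hb0 0) (ha0 0))
    | succ m ih =>
      intro hm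
      have h1 := ih (by omega)
      have h2 := mul_le_mul_of_nonneg_left (hratio m hm) hβ
      have h3 : (b (m + 1) - c (m + 1)) / ((m : ℝ) + 1)
          ≤ β * (b (m + 1) / a (m + 1) - c (m + 1) / a (m + 1)) := by
        have ham := ha (m + 1) hm
        push_cast at ham
        rcases (ha0 (m + 1)).eq_or_lt with h0 | hpos
        · have hb := hba (m + 1)
          have hbz : b (m + 1) = 0 := le_antisymm (h0 ▸ hb) (hb0 _)
          have hcz : c (m + 1) = 0 := le_antisymm (hbz ▸ hcb (m + 1)) (hc _)
          simp [hbz, hcz]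
        · rw [← sub_div, ← mul_div_assoc, div_le_div_iff₀ (by positivity) hpos]
          nlinarith [mul_le_mul_of_nonneg_left ham (sub_nonneg.mpr (hcb (m + 1)))]
      rw [Finset.sum_range_succ]
      linarith
  refine (step n le_rfl).trans (mul_le_of_le_one_right hβ ?_)
  exact div_le_one_of_le₀ (hba n) (ha0 n)

/-- Simes' inequality for PRDS p-values under the global null. -/
theorem measureReal_compl_bhAtMost_zero_le {Ω : Type*} [MeasurableSpace Ω] (μ : Measure Ω)
    [IsProbabilityMeasure μ] (K : ℕ) (hK : 0 < K) (P : Fin K → Ω → ℝ)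
    (hPmeas : ∀ k, Measurable (P k))
    (hsup : ∀ k, ∀ t ∈ Set.Icc (0:ℝ) 1, μ {ω | P k ω ≤ t} ≤ ENNReal.ofReal t)
    (hPRDS : ∀ k, ∀ A : Set (Fin K → ℝ), MeasurableSet A →
      (∀ x ∈ A, ∀ y : Fin K → ℝ, x ≤ y → y ∈ A) →
      ∀ x ∈ Set.Icc (0:ℝ) 1, ∀ y ∈ Set.Icc (0:ℝ) 1, x ≤ y →
        0 < μ {ω | P k ω ≤ x} → 0 < μ {ω | P k ω ≤ y} →
        μ ({ω | (fun j => P j ω) ∈ A} ∩ {ω | P k ω ≤ x}) / μ {ω | P k ω ≤ x}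
          ≤ μ ({ω | (fun j => P j ω) ∈ A} ∩ {ω | P k ω ≤ y}) / μ {ω | P k ω ≤ y})
    (α : ℝ) (hα : α ∈ Set.Icc (0:ℝ) 1) :
    μ.real {ω | (fun j => P j ω) ∈ bhAtMost K α 0}ᶜ ≤ α := by
  have hK0 : (0 : ℝ) < K := Nat.cast_pos.mpr hK
  set A : ℕ → Set Ω := fun r => {ω | (fun j => P j ω) ∈ bhAtMost K α r} with hA
  set F : Fin K → ℕ → Set Ω := fun k r => {ω | P k ω ≤ α / K * r} with hF
  have hAm : ∀ r, MeasurableSet (A r) := fun r =>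
    measurable_pi_lambda _ hPmeas (measurableSet_bhAtMost K α r)
  have hFm : ∀ k r, MeasurableSet (F k r) := fun k r =>
    measurableSet_le (hPmeas k) measurable_const
  have hAmono : Monotone A := fun r s hrs ω hω => bhAtMost_mono K α hrs hω
  have hAK : A K = Set.univ := by simp [hA, bhAtMost_self]
  have hlevel : ∀ r ≤ K, α / K * r ∈ Set.Icc (0 : ℝ) 1 := by
    intro r hr
    have hr' : (r : ℝ) ≤ K := Nat.cast_le.mpr hr
    refine ⟨mul_nonneg (div_nonneg hα.1 hK0.le) r.cast_nonneg, ?_⟩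
    rw [div_mul_eq_mul_div, div_le_one hK0]
    exact (mul_le_mul hα.2 hr' r.cast_nonneg zero_le_one).trans_eq (one_mul _)
  have hdiff : ∀ r (E : Set Ω), μ.real ((A (r + 1) \ A r) ∩ E)
      ≤ μ.real (A (r + 1) ∩ E) - μ.real (A r ∩ E) := by
    intro r E
    have h := measureReal_inter_add_sdiff (μ := μ) (s := A (r + 1) ∩ E) (hAm r)
    have h1 : A (r + 1) ∩ E ∩ A r = A r ∩ E := by
      rw [Set.inter_right_comm, Set.inter_eq_right.mpr (hAmono r.le_succ)]
    have h2 : (A (r + 1) ∩ E) \ A r = (A (r + 1) \ A r) ∩ E := Set.inter_sdiff_right_comm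
    rw [h1, h2] at h
    linarith
  have hsum : ∀ k, ∑ r ∈ Finset.range K,
      μ.real ((A (r + 1) \ A r) ∩ F k (r + 1)) / ((r : ℝ) + 1) ≤ α / K := by
    intro k
    refine le_trans (Finset.sum_le_sum fun r _ =>
      div_le_div_of_nonneg_right (hdiff r (F k (r + 1))) (by positivity)) ?_
    refine sum_sub_div_le_of_ratio_le (a := fun r => μ.real (F k r))
      (b := fun r => μ.real (A r ∩ F k r)) (c := fun r => μ.real (A (r - 1) ∩ F k r))
      (div_nonneg hα.1 hK0.le)
      (fun r => measureReal_mono (Set.inter_subset_inter_left _ (hAmono (Nat.sub_le r 1))))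
      (fun r => measureReal_nonneg) (fun r => measureReal_mono Set.inter_subset_right) K
      (fun r hr => ENNReal.toReal_le_of_le_ofReal (hlevel r hr).1 (hsup k _ (hlevel r hr))) ?_
    intro r hr
    simp only [Nat.add_sub_cancel]
    have hle : α / K * (r : ℝ) ≤ α / K * ((r + 1 : ℕ) : ℝ) :=
      mul_le_mul_of_nonneg_left (by simp) (div_nonneg hα.1 hK0.le)
    have hFle : μ (F k r) ≤ μ (F k (r + 1)) := measure_mono fun ω hω => le_trans hω hle
    rcases eq_zero_or_pos (μ (F k r)) with h0 | hpos
    · rw [measureReal_def μ (F k r), h0]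
      simpa using div_nonneg measureReal_nonneg measureReal_nonneg
    · have hpos' := hpos.trans_le hFle
      have := hPRDS k _ (measurableSet_bhAtMost K α r)
        (fun x hx y hxy => mem_bhAtMost_of_le hx hxy) _ (hlevel r hr.le) _
        (hlevel (r + 1) hr) hle hpos hpos'
      have := ENNReal.toReal_mono
        (ENNReal.div_ne_top (measure_ne_top μ _) hpos'.ne') this
      rwa [ENNReal.toReal_div, ENNReal.toReal_div] at this
  have hcount : ∀ r, μ.real (A (r + 1) \ A r)
      ≤ ∑ k, μ.real ((A (r + 1) \ A r) ∩ F k (r + 1)) / ((r : ℝ) + 1) := by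
    intro r
    rw [← Finset.sum_div, le_div_iff₀ (by positivity), mul_comm]
    have h := natCast_mul_measure_le_sum_measure_inter μ ((hAm (r + 1)).diff (hAm r))
      (fun k => hFm k (r + 1)) (r + 1) (fun ω hω => by
        have := le_bhCount_of_mem_diff hω
        refine this.trans_eq ?_
        simp only [bhCount, hF, Set.mem_ofPred_eq]
        congr 1
        ext k
        simp only [Finset.mem_filter, Finset.mem_univ, true_and]
        rw [div_mul_eq_mul_div, le_div_iff₀ hK0, mul_comm])
    have h' := ENNReal.toReal_mono
      (ENNReal.sum_ne_top.mpr fun k _ => measure_ne_top μ _) h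
    rw [ENNReal.toReal_mul, ENNReal.toReal_natCast,
      ENNReal.toReal_sum fun k _ => measure_ne_top μ _] at h'
    exact_mod_cast h'
  calc μ.real (A 0)ᶜ = ∑ r ∈ Finset.range K, μ.real (A (r + 1) \ A r) := by
        have : ∀ r, μ.real (A (r + 1) \ A r) = μ.real (A (r + 1)) - μ.real (A r) := fun r =>
          measureReal_sdiff (hAmono r.le_succ) (hAm r)
        rw [Finset.sum_congr rfl fun r _ => this r,
          Finset.sum_range_sub (fun r => μ.real (A r)), hAK, Set.compl_eq_univ_sdiff,
          measureReal_sdiff (Set.subset_univ _) (hAm 0)]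
    _ ≤ ∑ r ∈ Finset.range K, ∑ k, μ.real ((A (r + 1) \ A r) ∩ F k (r + 1)) / ((r : ℝ) + 1) :=
        Finset.sum_le_sum fun r _ => hcount r
    _ = ∑ k, ∑ r ∈ Finset.range K, μ.real ((A (r + 1) \ A r) ∩ F k (r + 1)) / ((r : ℝ) + 1) :=
        Finset.sum_comm
    _ ≤ ∑ _k : Fin K, α / K := Finset.sum_le_sum fun k _ => hsum k
    _ = α := by
        simp only [Finset.sum_const, Finset.card_univ, Fintype.card_fin, nsmul_eq_mul]
        field_simp

/-- **MABH.** For `K ≥ 2`, PRDS p-values and `α ∈ (0,1)` with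
`α ≤ (K−1)/K`, the MABH quantities `E_k = (K/(K−1))·1{R_{BH,α}(P) > 0}` are compound
e-values: `∑_{k∈𝒩} 𝔼[(K/(K−1))·1{R_{BH,α}(P) > 0}] ≤ K`. -/
theorem mabh_compound
    {Ω : Type*} [MeasurableSpace Ω] (μ : Measure Ω) [IsProbabilityMeasure μ]
    (K : ℕ) (hK : 2 ≤ K) (N : Finset (Fin K))
    (P : Fin K → Ω → ℝ)
    (hPmeas : ∀ k, Measurable (P k))
    (hPrange : ∀ k ω, P k ω ∈ Set.Icc (0:ℝ) 1)
    -- the p-values are PRDS: null p-values are superuniform …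
    (hsup : ∀ k ∈ N, ∀ t ∈ Set.Icc (0:ℝ) 1, μ {ω | P k ω ≤ t} ≤ ENNReal.ofReal t)
    -- … and conditional probabilities of non-decreasing sets are monotone:
    (hPRDS : ∀ k ∈ N, ∀ A : Set (Fin K → ℝ), MeasurableSet A →
      (∀ x ∈ A, ∀ y : Fin K → ℝ, x ≤ y → y ∈ A) →
      ∀ x ∈ Set.Icc (0:ℝ) 1, ∀ y ∈ Set.Icc (0:ℝ) 1, x ≤ y →
        0 < μ {ω | P k ω ≤ x} → 0 < μ {ω | P k ω ≤ y} →
        μ ({ω | (fun j => P j ω) ∈ A} ∩ {ω | P k ω ≤ x}) / μ {ω | P k ω ≤ x}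
          ≤ μ ({ω | (fun j => P j ω) ∈ A} ∩ {ω | P k ω ≤ y}) / μ {ω | P k ω ≤ y})
    (α : ℝ) (hα : α ∈ Set.Ioo (0:ℝ) 1) (hαK : α ≤ ((K : ℝ) - 1) / K) :
    ∑ k ∈ N, ∫⁻ ω, ENNReal.ofReal
        (((K : ℝ) / ((K : ℝ) - 1)) *
          (if 0 < RBH α (fun j => P j ω) then (1:ℝ) else 0)) ∂μ
      ≤ (K : ℝ≥0∞) := by
  have hK1 : (0 : ℝ) < (K : ℝ) - 1 := by
    have : (2 : ℝ) ≤ K := by exact_mod_cast hK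
    linarith
  have hK0 : (0 : ℝ) < K := by linarith
  set S : Set Ω := {ω | (fun j => P j ω) ∈ bhAtMost K α 0}ᶜ with hS
  have hSm : MeasurableSet S :=
    (measurable_pi_lambda _ hPmeas (measurableSet_bhAtMost K α 0)).compl
  have hbound : (N.card : ℝ) * μ.real S ≤ (K : ℝ) - 1 := by
    by_cases hN : N = Finset.univ
    · subst hN
      have h := measureReal_compl_bhAtMost_zero_le μ K (by omega) P hPmeas
        (fun k => hsup k (Finset.mem_univ k)) (fun k => hPRDS k (Finset.mem_univ k)) α
        ⟨hα.1.le, hα.2.le⟩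
      rw [le_div_iff₀ hK0] at hαK
      rw [Finset.card_univ, Fintype.card_fin, mul_comm]
      exact (mul_le_mul_of_nonneg_right h hK0.le).trans hαK
    · have hcard : N.card < K := by
        simpa using Finset.card_lt_univ_of_notMem
          (Classical.not_forall.mp (mt Finset.eq_univ_iff_forall.mpr hN)).choose_spec
      have hcard' : (N.card : ℝ) + 1 ≤ K := by exact_mod_cast hcard
      have := mul_le_of_le_one_right (Nat.cast_nonneg (α := ℝ) N.card)
        (measureReal_le_one (μ := μ) (s := S))
      linarith
  have hint : ∫⁻ ω, ENNReal.ofReal (((K : ℝ) / ((K : ℝ) - 1)) *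
      (if 0 < RBH α (fun j => P j ω) then (1:ℝ) else 0)) ∂μ
      ≤ ENNReal.ofReal ((K : ℝ) / ((K : ℝ) - 1) * μ.real S) := by
    calc _ ≤ ∫⁻ ω, S.indicator (fun _ => ENNReal.ofReal ((K : ℝ) / ((K : ℝ) - 1))) ω ∂μ := by
          refine lintegral_mono fun ω => ?_
          split_ifs with h
          · have hω : ω ∈ S :=
              notMem_bhAtMost_zero_of_RBH_pos hα.1.le h
            simp [hω]
          · simp
      _ = _ := by
          rw [lintegral_indicator_const hSm, ENNReal.ofReal_mul (div_nonneg hK0.le hK1.le),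
            ofReal_measureReal]
  refine (Finset.sum_le_sum fun _ _ => hint).trans ?_
  rw [Finset.sum_const, nsmul_eq_mul, ← ENNReal.ofReal_natCast, ← ENNReal.ofReal_natCast,
    ← ENNReal.ofReal_mul (by positivity)]
  refine ENNReal.ofReal_le_ofReal ?_
  rw [mul_left_comm, div_mul_eq_mul_div, div_le_iff₀ hK1]
  exact mul_le_mul_of_nonneg_left hbound hK0.le
end
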